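/- arXiv:2508.13466 — 2 statements merged into one kernel-verified Lean document; each statement's English description precedes it below -/
import Mathlib

section
/- Let p ≥ 1 and b ≥ 3 be integers, and let T be the extra special graph ES_{b;p} with leaves as boundary. Then the Steklov eigenvalues of T are σ1 = 0, σ2 = σ⁻, σ3 = σ⁺, and σ4 = … = σ_b = 1/p, where σ^± = (2bp + 3b − 3 ± √(b² − 2b + 9)) / (2(bp² + 3bp − 3p + 2b − 4)); if b = 3 the eigenvalue 1/p does not occur. -/
open scoped Classical

noncomputable section

/-- The `k`-th smallest root (1-based, with multiplicity) of the characteristic polynomial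
of a real matrix.  For a symmetric matrix these are exactly its eigenvalues listed
in nondecreasing order. -/
def kthEig {ι : Type*} [Fintype ι] [DecidableEq ι] (M : Matrix ι ι ℝ) (k : ℕ) : ℝ :=
  (M.charpoly.roots.sort (· ≤ ·)).getD (k - 1) 0

/-- The `k`-th smallest Laplacian eigenvalue (1-based); `lapEig G 2` is the algebraic
connectivity. -/
def lapEig {V : Type*} [Fintype V] (G : SimpleGraph V) (k : ℕ) : ℝ :=
  kthEig (SimpleGraph.lapMatrix ℝ G) k

/-- The Steklov (Dirichlet-to-Neumann) matrix of a graph with boundary `B`: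
the Schur complement of the interior block of the Laplacian, i.e. the matrix of the map
sending `f : B → ℝ` to the normal derivative of its harmonic extension. -/
def steklovMatrix {V : Type*} [Fintype V] (G : SimpleGraph V) (B : Set V) :
    Matrix B B ℝ :=
  let L := SimpleGraph.lapMatrix ℝ G
  L.submatrix (Subtype.val : B → V) (Subtype.val : B → V) -
    L.submatrix (Subtype.val : B → V) (Subtype.val : (Bᶜ : Set V) → V) *
      (L.submatrix (Subtype.val : (Bᶜ : Set V) → V) (Subtype.val : (Bᶜ : Set V) → V))⁻¹ *
      L.submatrix (Subtype.val : (Bᶜ : Set V) → V) (Subtype.val : B → V)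

/-- The `k`-th smallest Steklov eigenvalue (1-based). -/
def steklovEig {V : Type*} [Fintype V] (G : SimpleGraph V) (B : Set V) (k : ℕ) : ℝ :=
  kthEig (steklovMatrix G B) k

/-- The set of leaves (vertices of degree 1) of a graph. -/
def leaves {V : Type*} (G : SimpleGraph V) : Set V := {v | (G.neighborSet v).ncard = 1}

/-- A set of edges is a matching if the edges belong to the graph and are pairwise
vertex-disjoint. -/
def IsMatchingSet {V : Type*} (G : SimpleGraph V) (s : Set (Sym2 V)) : Prop :=
  s ⊆ G.edgeSet ∧ s.Pairwise fun e f => ∀ v, v ∈ e → v ∉ f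

/-- The matching number of a graph: the maximum size of a matching. -/
def matchingNumber {V : Type*} [Fintype V] (G : SimpleGraph V) : ℕ :=
  sSup {n | ∃ s : Set (Sym2 V), IsMatchingSet G s ∧ s.ncard = n}

/-- The star graph on `n` vertices. -/
def starGraph (n : ℕ) : SimpleGraph (Fin n) :=
  SimpleGraph.fromRel (fun i _ => i.val = 0)

/-- Vertices of the spider graph with two leg lengths. -/
abbrev Spider2V (p₁ p₂ ℓ₁ ℓ₂ : ℕ) := Option ((Fin p₁ × Fin ℓ₁) ⊕ (Fin p₂ × Fin ℓ₂))

def spider2Rel (p₁ p₂ ℓ₁ ℓ₂ : ℕ) :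
    Spider2V p₁ p₂ ℓ₁ ℓ₂ → Spider2V p₁ p₂ ℓ₁ ℓ₂ → Prop
  | none, some (Sum.inl (_, j)) => j.val = 0
  | none, some (Sum.inr (_, j)) => j.val = 0
  | some (Sum.inl (i, j)), some (Sum.inl (i', j')) => i = i' ∧ j'.val = j.val + 1
  | some (Sum.inr (i, j)), some (Sum.inr (i', j')) => i = i' ∧ j'.val = j.val + 1
  | _, _ => False

/-- The spider graph `Sp_{p₁,p₂;ℓ₁,ℓ₂}`: `p₁` paths of length `ℓ₁` and `p₂` paths of
length `ℓ₂`, with one endpoint of each path identified to a common center (`none`). -/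
def spider2 (p₁ p₂ ℓ₁ ℓ₂ : ℕ) : SimpleGraph (Spider2V p₁ p₂ ℓ₁ ℓ₂) :=
  SimpleGraph.fromRel (spider2Rel p₁ p₂ ℓ₁ ℓ₂)

/-- Vertices of the crab graph. -/
abbrev CrabV (b₁ b₂ r : ℕ) := Option (Fin b₁ × Fin r) ⊕ Option (Fin b₂ × Fin r)

def crabRel (b₁ b₂ r : ℕ) : CrabV b₁ b₂ r → CrabV b₁ b₂ r → Prop
  | Sum.inl none, Sum.inr none => True
  | Sum.inl none, Sum.inl (some (_, j)) => j.val = 0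
  | Sum.inl (some (i, j)), Sum.inl (some (i', j')) => i = i' ∧ j'.val = j.val + 1
  | Sum.inr none, Sum.inr (some (_, j)) => j.val = 0
  | Sum.inr (some (i, j)), Sum.inr (some (i', j')) => i = i' ∧ j'.val = j.val + 1
  | _, _ => False

/-- The crab graph `CG_{b₁,b₂;r}`: two spiders `Sp_{b₁;r}` and `Sp_{b₂;r}` with their
centers joined by an edge. -/
def crab (b₁ b₂ r : ℕ) : SimpleGraph (CrabV b₁ b₂ r) :=
  SimpleGraph.fromRel (crabRel b₁ b₂ r)


/-- Vertices of the spider graph with three leg lengths. -/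
abbrev Spider3V (p₁ p₂ p₃ ℓ₁ ℓ₂ ℓ₃ : ℕ) :=
  Option ((Fin p₁ × Fin ℓ₁) ⊕ (Fin p₂ × Fin ℓ₂) ⊕ (Fin p₃ × Fin ℓ₃))

def spider3Rel (p₁ p₂ p₃ ℓ₁ ℓ₂ ℓ₃ : ℕ) :
    Spider3V p₁ p₂ p₃ ℓ₁ ℓ₂ ℓ₃ → Spider3V p₁ p₂ p₃ ℓ₁ ℓ₂ ℓ₃ → Prop
  | none, some (Sum.inl (_, j)) => j.val = 0
  | none, some (Sum.inr (Sum.inl (_, j))) => j.val = 0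
  | none, some (Sum.inr (Sum.inr (_, j))) => j.val = 0
  | some (Sum.inl (i, j)), some (Sum.inl (i', j')) => i = i' ∧ j'.val = j.val + 1
  | some (Sum.inr (Sum.inl (i, j))), some (Sum.inr (Sum.inl (i', j'))) =>
      i = i' ∧ j'.val = j.val + 1
  | some (Sum.inr (Sum.inr (i, j))), some (Sum.inr (Sum.inr (i', j'))) =>
      i = i' ∧ j'.val = j.val + 1
  | _, _ => False

/-- The spider graph `Sp_{p₁,p₂,p₃;ℓ₁,ℓ₂,ℓ₃}`. -/
def spider3 (p₁ p₂ p₃ ℓ₁ ℓ₂ ℓ₃ : ℕ) : SimpleGraph (Spider3V p₁ p₂ p₃ ℓ₁ ℓ₂ ℓ₃) :=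
  SimpleGraph.fromRel (spider3Rel p₁ p₂ p₃ ℓ₁ ℓ₂ ℓ₃)

/-- The extra special graph `ES_{b;p} = Sp_{1,1,b−2;p+2,p+1,p}`. -/
def extraSpecial (b p : ℕ) : SimpleGraph (Spider3V 1 1 (b - 2) (p + 2) (p + 1) p) :=
  spider3 1 1 (b - 2) (p + 2) (p + 1) p

open Matrix

section SteklovGeneral

variable {V : Type*} [Fintype V] (G : SimpleGraph V) (B : Set V)

/-- The graph Laplacian acting on functions. -/
def laplacian (f : V → ℝ) (v : V) : ℝ :=
  ∑ w, if G.Adj v w then f v - f w else 0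

theorem lapMatrix_mulVec_apply_eq_laplacian (f : V → ℝ) (v : V) :
    (SimpleGraph.lapMatrix ℝ G *ᵥ f) v = laplacian G f v := by
  rw [laplacian, SimpleGraph.lapMatrix_mulVec_apply, SimpleGraph.degree_eq_sum_if_adj,
    Finset.sum_mul, SimpleGraph.neighborFinset_eq_filter, Finset.sum_filter, ← Finset.sum_sub_distrib]
  refine Finset.sum_congr rfl fun w _ => ?_
  split_ifs <;> simp

theorem mulVec_apply_eq_submatrix_add (L : Matrix V V ℝ) (f : V → ℝ) (v : V) :
    (L *ᵥ f) v = (∑ w : B, L v w * f w) + ∑ w : (Bᶜ : Set V), L v w * f w := by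
  simp only [mulVec, dotProduct]
  exact (Fintype.sum_subtype_add_sum_subtype (· ∈ B) fun w => L v w * f w).symm

/-- The interior block of the Laplacian is invertible when every vertex is joined to the
boundary. -/
theorem isUnit_det_lapMatrix_interior (hB : ∀ v, ∃ w ∈ B, G.Reachable v w) :
    IsUnit ((SimpleGraph.lapMatrix ℝ G).submatrix (Subtype.val : (Bᶜ : Set V) → V)
      (Subtype.val : (Bᶜ : Set V) → V)).det := by
  rw [← isUnit_iff_isUnit_det, ← mulVec_injective_iff_isUnit]
  rw [← Matrix.coe_mulVecLin, injective_iff_map_eq_zero]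
  intro u hu
  set f : V → ℝ := fun v => if h : v ∈ Bᶜ then u ⟨v, h⟩ else 0 with hf
  have hfB : ∀ v ∈ B, f v = 0 := fun v hv => by simp [hf, hv]
  have hfI : ∀ v : (Bᶜ : Set V), f v = u v := fun v => by
    have := v.2
    simp only [hf, this, dite_true]
  have hzero : Matrix.toLinearMap₂' ℝ (SimpleGraph.lapMatrix ℝ G) f f = 0 := by
    rw [Matrix.toLinearMap₂'_apply', dotProduct]
    refine Finset.sum_eq_zero fun v _ => ?_
    by_cases hv : v ∈ B
    · rw [hfB v hv, zero_mul]
    · have h := congrFun hu ⟨v, hv⟩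
      rw [mulVec_apply_eq_submatrix_add B]
      simp only [hfI]
      rw [Finset.sum_eq_zero fun w _ => by rw [hfB w w.2, mul_zero], zero_add]
      simp only [Matrix.mulVecLin_apply, mulVec, dotProduct, submatrix_apply,
        Pi.zero_apply] at h
      rw [h, mul_zero]
  rw [SimpleGraph.lapMatrix_toLinearMap₂'_apply'_eq_zero_iff_forall_reachable] at hzero
  ext v
  obtain ⟨w, hw, hvw⟩ := hB v
  rw [← hfI v, hzero v w hvw, hfB w hw, Pi.zero_apply]

/-- The Steklov matrix sends the boundary values of a function harmonic at the interior
vertices to its normal derivative. -/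
theorem steklovMatrix_mulVec_of_harmonic (hB : ∀ v, ∃ w ∈ B, G.Reachable v w) (f : V → ℝ)
    (hf : ∀ v ∉ B, laplacian G f v = 0) (x : B) :
    (steklovMatrix G B *ᵥ fun y : B => f y) x = laplacian G f x := by
  simp only [← lapMatrix_mulVec_apply_eq_laplacian] at hf ⊢
  have hdet := isUnit_det_lapMatrix_interior G B hB
  set L := SimpleGraph.lapMatrix ℝ G with hL
  set A := L.submatrix (Subtype.val : (Bᶜ : Set V) → V) (Subtype.val : (Bᶜ : Set V) → V) with hA
  have hIB : (L.submatrix (Subtype.val : (Bᶜ : Set V) → V) (Subtype.val : B → V)) *ᵥ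
      (fun y : B => f y) = - (A *ᵥ fun y : (Bᶜ : Set V) => f y) := by
    ext v
    have h := hf v v.2
    rw [mulVec_apply_eq_submatrix_add B] at h
    simp only [mulVec, dotProduct, submatrix_apply, Pi.neg_apply, hA]
    linarith
  have hS : steklovMatrix G B = L.submatrix (Subtype.val : B → V) (Subtype.val : B → V) -
    L.submatrix (Subtype.val : B → V) (Subtype.val : (Bᶜ : Set V) → V) * A⁻¹ *
      L.submatrix (Subtype.val : (Bᶜ : Set V) → V) (Subtype.val : B → V) := rfl
  rw [hS, sub_mulVec, ← mulVec_mulVec, hIB, mulVec_neg, mulVec_mulVec, Matrix.mul_assoc,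
    nonsing_inv_mul _ hdet, Matrix.mul_one, mulVec_apply_eq_submatrix_add B]
  simp [mulVec, dotProduct]

end SteklovGeneral

section Transfer

variable {V W : Type*} {G : SimpleGraph V} {H : SimpleGraph W}

theorem lapMatrix_eq_submatrix_of_iso [Fintype V] [Fintype W] (e : G ≃g H) :
    SimpleGraph.lapMatrix ℝ G = (SimpleGraph.lapMatrix ℝ H).submatrix e e := by
  ext v w
  simp [SimpleGraph.lapMatrix, SimpleGraph.degMatrix, diagonal_apply,
    SimpleGraph.adjMatrix_apply, e.map_adj_iff, e.degree_eq]

theorem mem_leaves_iff_of_iso (e : G ≃g H) (v : V) : v ∈ leaves G ↔ e v ∈ leaves H := by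
  simp only [leaves, Set.mem_ofPred_eq]
  rw [← Nat.card_coe_set_eq, ← Nat.card_coe_set_eq, Nat.card_congr (e.mapNeighborSet v)]

/-- The Steklov matrix with respect to the leaves is an isomorphism invariant. -/
theorem steklovMatrix_leaves_of_iso [Fintype V] [Fintype W] (e : G ≃g H) :
    steklovMatrix G (leaves G) = (steklovMatrix H (leaves H)).submatrix
      (e.toEquiv.subtypeEquiv (mem_leaves_iff_of_iso e))
      (e.toEquiv.subtypeEquiv (mem_leaves_iff_of_iso e)) := by
  set eB : leaves G ≃ leaves H := e.toEquiv.subtypeEquiv (mem_leaves_iff_of_iso e)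
  let eI : ((leaves G)ᶜ : Set V) ≃ ((leaves H)ᶜ : Set W) :=
    e.toEquiv.subtypeEquiv fun v => not_congr (mem_leaves_iff_of_iso e v)
  simp only [steklovMatrix, submatrix_sub, Pi.sub_apply]
  rw [lapMatrix_eq_submatrix_of_iso e, submatrix_mul _ _ _ eI _ eI.bijective,
    submatrix_mul _ _ _ eI _ eI.bijective, ← inv_submatrix_equiv]
  rfl

theorem charpoly_steklovMatrix_leaves_of_iso [Fintype V] [Fintype W] (e : G ≃g H)
    [Fintype (leaves G)] [DecidableEq (leaves G)] [Fintype (leaves H)] [DecidableEq (leaves H)] :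
    (steklovMatrix G (leaves G)).charpoly = (steklovMatrix H (leaves H)).charpoly := by
  have h := charpoly_reindex (e.toEquiv.subtypeEquiv (mem_leaves_iff_of_iso e)).symm
    (steklovMatrix H (leaves H))
  rw [reindex_apply, Equiv.symm_symm] at h
  rw [steklovMatrix_leaves_of_iso e, h]

end Transfer

theorem eval_charpoly_diagonal_sub_smul_vecMulVec {ι : Type*} [Fintype ι] [DecidableEq ι]
    (c : ι → ℝ) (S x : ℝ) (hx : ∀ i, x ≠ c i) :
    (diagonal c - S⁻¹ • vecMulVec c c).charpoly.eval x =
      (∏ i, (x - c i)) * (1 + S⁻¹ * ∑ i, c i ^ 2 / (x - c i)) := by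
  have hA : IsUnit (diagonal fun i => x - c i).det := by
    rw [det_diagonal, isUnit_iff_ne_zero, Finset.prod_ne_zero_iff]
    exact fun i _ => sub_ne_zero.2 (hx i)
  have hM : scalar ι x - (diagonal c - S⁻¹ • vecMulVec c c) = (diagonal fun i => x - c i) +
      replicateCol Unit c * replicateRow Unit (S⁻¹ • c) := by
    ext i j
    by_cases hij : i = j
    · simp [hij, vecMulVec_apply, mul_apply]
      ring
    · simp [hij, vecMulVec_apply, mul_apply]
  have hinv : (diagonal fun i => x - c i)⁻¹ = diagonal fun i => (x - c i)⁻¹ := by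
    refine inv_eq_right_inv ?_
    rw [diagonal_mul_diagonal, ← diagonal_one]
    congr 1
    ext i
    exact mul_inv_cancel₀ (sub_ne_zero.2 (hx i))
  rw [eval_charpoly, hM, det_add_replicateCol_mul_replicateRow hA, det_diagonal, hinv]
  congr 1
  simp only [det_unique, Matrix.add_apply, one_apply_eq, mul_apply, replicateRow_apply,
    replicateCol_apply, diagonal_apply, mul_ite, mul_zero, Finset.sum_ite_eq', Finset.mem_univ,
    if_true, Pi.smul_apply, smul_eq_mul, Finset.mul_sum]
  congr 1
  refine Finset.sum_congr rfl fun i _ => ?_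
  ring

section Spider

variable {ι : Type*} (ℓ : ι → ℕ)

def spiderRel : Option (Σ i, Fin (ℓ i)) → Option (Σ i, Fin (ℓ i)) → Prop
  | none, some x => x.2.val = 0
  | some x, some y => x.1 = y.1 ∧ y.2.val = x.2.val + 1
  | _, _ => False

/-- The spider graph with one leg of length `ℓ i` for each `i`. -/
def spider : SimpleGraph (Option (Σ i, Fin (ℓ i))) :=
  SimpleGraph.fromRel (spiderRel ℓ)

theorem spider_adj_none_none : ¬ (spider ℓ).Adj none none := by
  simp [spider]

theorem spider_adj_none_some (x : Σ i, Fin (ℓ i)) :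
    (spider ℓ).Adj none (some x) ↔ x.2.val = 0 := by
  simp [spider, spiderRel]

theorem spider_adj_some_none (x : Σ i, Fin (ℓ i)) :
    (spider ℓ).Adj (some x) none ↔ x.2.val = 0 := by
  simp [spider, spiderRel]

theorem spider_adj_some_some (x y : Σ i, Fin (ℓ i)) :
    (spider ℓ).Adj (some x) (some y) ↔
      x.1 = y.1 ∧ (y.2.val = x.2.val + 1 ∨ x.2.val = y.2.val + 1) := by
  simp only [spider, SimpleGraph.fromRel_adj, spiderRel]
  constructor
  · rintro ⟨-, h | h⟩
    · exact ⟨h.1, Or.inl h.2⟩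
    · exact ⟨h.1.symm, Or.inr h.2⟩
  · rintro ⟨h, h'⟩
    refine ⟨?_, ?_⟩
    · intro hxy
      rw [Option.some.injEq] at hxy
      subst hxy
      omega
    · exact h'.imp (fun k => ⟨h, k⟩) fun k => ⟨h.symm, k⟩

theorem sum_fin_ite_consecutive {n j : ℕ} (hj : j < n) (φ : ℕ → ℝ) :
    (∑ k : Fin n, if k.val = j + 1 ∨ j = k.val + 1 then φ k else 0) =
      (if j + 1 < n then φ (j + 1) else 0) + if 1 ≤ j then φ (j - 1) else 0 := by
  rw [Fin.sum_univ_eq_sum_range (fun k => if k = j + 1 ∨ j = k + 1 then φ k else 0) n]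
  have hsplit : ∀ k ∈ Finset.range n, (if k = j + 1 ∨ j = k + 1 then φ k else 0) =
      (if j + 1 = k then φ k else 0) + if j - 1 = k then (if 1 ≤ j then φ k else 0) else 0 := by
    intro k _
    split_ifs <;> first | omega | simp
  have hj' : j - 1 < n := by omega
  rw [Finset.sum_congr rfl hsplit, Finset.sum_add_distrib, Finset.sum_ite_eq, Finset.sum_ite_eq]
  simp [hj']

variable [Fintype ι]

theorem spider_sum_adj_none (g : Option (Σ i, Fin (ℓ i)) → ℝ) (hℓ : ∀ i, 1 ≤ ℓ i) :
    (∑ w, if (spider ℓ).Adj none w then g w else 0) = ∑ i, g (some ⟨i, ⟨0, hℓ i⟩⟩) := by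
  rw [Fintype.sum_option, if_neg (spider_adj_none_none ℓ), zero_add, Fintype.sum_sigma]
  refine Finset.sum_congr rfl fun i _ => ?_
  simp only [spider_adj_none_some]
  rw [Finset.sum_eq_single ⟨0, hℓ i⟩]
  · simp
  · intro k _ hk
    rw [if_neg]
    exact fun h => hk (Fin.ext h)
  · simp

theorem spider_sum_adj_some (g : Option (Σ i, Fin (ℓ i)) → ℝ) (i : ι) (j : Fin (ℓ i)) (φ : ℕ → ℝ)
    (hφ : ∀ k : Fin (ℓ i), g (some ⟨i, k⟩) = φ k) :
    (∑ w, if (spider ℓ).Adj (some ⟨i, j⟩) w then g w else 0) =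
      (if j.val = 0 then g none else φ (j - 1)) + if j.val + 1 < ℓ i then φ (j + 1) else 0 := by
  rw [Fintype.sum_option, Fintype.sum_sigma, Finset.sum_eq_single i]
  · simp only [spider_adj_some_none, spider_adj_some_some, true_and, hφ]
    rw [sum_fin_ite_consecutive j.2]
    rcases Nat.eq_zero_or_pos j.val with h | h
    · simp [h]
    · simp [h.ne', Nat.succ_le_of_lt h, add_comm]
  · intro i' _ hi'
    simp only [spider_adj_some_some, hi'.symm, false_and, if_false, Finset.sum_const_zero]
  · simp

theorem ncard_neighborSet_eq_sum {V : Type*} [Fintype V] (G : SimpleGraph V) (v : V) :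
    ((G.neighborSet v).ncard : ℝ) = ∑ w, if G.Adj v w then 1 else 0 := by
  rw [← SimpleGraph.degree_eq_sum_if_adj, ← SimpleGraph.card_neighborSet_eq_degree,
    ← Nat.card_coe_set_eq, Nat.card_eq_fintype_card]

theorem none_notMem_leaves_spider (hℓ : ∀ i, 1 ≤ ℓ i) (hι : 2 ≤ Fintype.card ι) :
    none ∉ leaves (spider ℓ) := by
  intro h
  have h1 : ((spider ℓ).neighborSet none).ncard = 1 := h
  have h2 := ncard_neighborSet_eq_sum (spider ℓ) none
  rw [spider_sum_adj_none ℓ _ hℓ, h1] at h2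
  simp only [Finset.sum_const, Finset.card_univ, nsmul_eq_mul, mul_one] at h2
  have h3 : 1 = Fintype.card ι := by exact_mod_cast h2
  omega

theorem some_mem_leaves_spider_iff (i : ι) (j : Fin (ℓ i)) :
    some ⟨i, j⟩ ∈ leaves (spider ℓ) ↔ j.val + 1 = ℓ i := by
  have h2 := ncard_neighborSet_eq_sum (spider ℓ) (some ⟨i, j⟩)
  rw [spider_sum_adj_some ℓ _ i j (fun _ => 1) fun _ => rfl, ite_self] at h2
  have hj := j.2
  change ((spider ℓ).neighborSet (some ⟨i, j⟩)).ncard = 1 ↔ _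
  rw [← Nat.cast_inj (R := ℝ), h2]
  split_ifs with h
  · norm_num
    omega
  · norm_num
    omega

theorem exists_leaf_reachable_spider [Nonempty ι] (hℓ : ∀ i, 1 ≤ ℓ i)
    (v : Option (Σ i, Fin (ℓ i))) : ∃ w ∈ leaves (spider ℓ), (spider ℓ).Reachable v w := by
  have hleg : ∀ d : ℕ, ∀ i, ∀ j : Fin (ℓ i), j.val + d + 1 = ℓ i →
      ∃ w ∈ leaves (spider ℓ), (spider ℓ).Reachable (some ⟨i, j⟩) w := by
    intro d
    induction d with
    | zero => exact fun i j h =>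
        ⟨_, (some_mem_leaves_spider_iff ℓ i j).2 (by omega), SimpleGraph.Reachable.refl _⟩
    | succ d ih =>
      intro i j h
      obtain ⟨w, hw, hr⟩ := ih i ⟨j.val + 1, by omega⟩ (by simp only; omega)
      refine ⟨w, hw, SimpleGraph.Reachable.trans (SimpleGraph.Adj.reachable ?_) hr⟩
      simp [spider_adj_some_some]
  have hsome : ∀ x : (Σ i, Fin (ℓ i)), ∃ w ∈ leaves (spider ℓ),
      (spider ℓ).Reachable (some x) w := fun ⟨i, j⟩ =>
    hleg (ℓ i - 1 - j.val) i j (by have := j.2; omega)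
  rcases v with _ | x
  · obtain ⟨i⟩ := ‹Nonempty ι›
    obtain ⟨w, hw, hr⟩ := hsome ⟨i, ⟨0, hℓ i⟩⟩
    refine ⟨w, hw, SimpleGraph.Reachable.trans (SimpleGraph.Adj.reachable ?_) hr⟩
    simp [spider_adj_none_some]
  · exact hsome x

/-- The leaves of a spider are indexed by its legs. -/
def spiderLeafEquiv (hℓ : ∀ i, 1 ≤ ℓ i) (hι : 2 ≤ Fintype.card ι) : ι ≃ leaves (spider ℓ) :=
  Equiv.ofBijective
    (fun i => ⟨some ⟨i, ⟨ℓ i - 1, Nat.sub_lt (hℓ i) one_pos⟩⟩,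
      (some_mem_leaves_spider_iff ℓ i _).2 (Nat.sub_add_cancel (hℓ i))⟩) <| by
    refine ⟨fun i i' h => ?_, ?_⟩
    · simp only [Subtype.mk.injEq, Option.some.injEq, Sigma.mk.injEq] at h
      exact h.1
    · rintro ⟨_ | ⟨i, j⟩, hx⟩
      · exact absurd hx (none_notMem_leaves_spider ℓ hℓ hι)
      · refine ⟨i, Subtype.ext (congrArg some (Sigma.ext rfl (heq_of_eq (Fin.ext ?_))))⟩
        have := (some_mem_leaves_spider_iff ℓ i j).1 hx
        simp only
        omega

/-- The function on a spider taking the value `h` at the center, with slope `s i` on leg `i`. -/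
def spiderAffine (h : ℝ) (s : ι → ℝ) : Option (Σ i, Fin (ℓ i)) → ℝ
  | none => h
  | some x => h + s x.1 * (x.2.val + 1)

theorem laplacian_spiderAffine_none (hℓ : ∀ i, 1 ≤ ℓ i) (h : ℝ) (s : ι → ℝ) :
    laplacian (spider ℓ) (spiderAffine ℓ h s) none = - ∑ i, s i := by
  rw [laplacian, spider_sum_adj_none ℓ _ hℓ]
  simp [spiderAffine]

theorem laplacian_spiderAffine_some (h : ℝ) (s : ι → ℝ) (i : ι) (j : Fin (ℓ i)) :
    laplacian (spider ℓ) (spiderAffine ℓ h s) (some ⟨i, j⟩) =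
      if j.val + 1 = ℓ i then s i else 0 := by
  rw [laplacian, spider_sum_adj_some ℓ _ i j
    (fun k => h + s i * (j.val + 1) - (h + s i * (k + 1))) fun k => rfl]
  have hj := j.2
  simp only [spiderAffine]
  have h1 : (if j.val = 0 then h + s i * (j.val + 1) - h
      else h + s i * (j.val + 1) - (h + s i * (((j.val - 1 : ℕ) : ℝ) + 1))) = s i := by
    split_ifs with h0
    · simp [h0]
    · rw [Nat.cast_sub (by omega)]
      push_cast
      ring
  rw [h1]
  split_ifs
  · omega
  · push_cast
    ring
  · ring
  · omega

theorem steklovMatrix_spider (hℓ : ∀ i, 1 ≤ ℓ i) (hι : 2 ≤ Fintype.card ι) :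
    (steklovMatrix (spider ℓ) (leaves (spider ℓ))).submatrix (spiderLeafEquiv ℓ hℓ hι)
      (spiderLeafEquiv ℓ hℓ hι) = diagonal (fun i => (ℓ i : ℝ)⁻¹) -
        (∑ i, (ℓ i : ℝ)⁻¹)⁻¹ • vecMulVec (fun i => (ℓ i : ℝ)⁻¹) (fun i => (ℓ i : ℝ)⁻¹) := by
  have : Nonempty ι := Fintype.card_pos_iff.1 (by omega)
  set e := spiderLeafEquiv ℓ hℓ hι
  set S := ∑ i, (ℓ i : ℝ)⁻¹ with hS
  have hpos : ∀ i, (0 : ℝ) < ℓ i := fun i => by exact_mod_cast hℓ i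
  have hS0 : S ≠ 0 := (Finset.sum_pos (fun i _ => inv_pos.2 (hpos i)) Finset.univ_nonempty).ne'
  refine Matrix.mulVec_injective (funext fun a => ?_)
  set h : ℝ := S⁻¹ * ∑ i, (ℓ i : ℝ)⁻¹ * a i with hh
  set s : ι → ℝ := fun i => (ℓ i : ℝ)⁻¹ * (a i - h) with hs
  have hsum : ∑ i, s i = 0 := by
    simp only [hs, mul_sub, Finset.sum_sub_distrib, ← Finset.sum_mul, ← hS, hh]
    rw [mul_inv_cancel_left₀ hS0, sub_self]
  have hval : ∀ i, spiderAffine ℓ h s (e i) = a i := fun i => by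
    change h + s i * (((ℓ i - 1 : ℕ) : ℝ) + 1) = a i
    rw [Nat.cast_sub (hℓ i), hs]
    have := (hpos i).ne'
    field_simp
    push_cast
    ring
  have hharm : ∀ v ∉ leaves (spider ℓ),
      laplacian (spider ℓ) (spiderAffine ℓ h s) v = 0 := by
    rintro (_ | ⟨i, j⟩) hv
    · rw [laplacian_spiderAffine_none ℓ hℓ, hsum, neg_zero]
    · rw [laplacian_spiderAffine_some,
        if_neg fun hj => hv ((some_mem_leaves_spider_iff ℓ i j).2 hj)]
  ext i
  have key := steklovMatrix_mulVec_of_harmonic (spider ℓ) (leaves (spider ℓ))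
    (exists_leaf_reachable_spider ℓ hℓ) _ hharm (e i)
  have hnormal : laplacian (spider ℓ) (spiderAffine ℓ h s) (e i) = s i := by
    refine (laplacian_spiderAffine_some ℓ h s i _).trans (if_pos ?_)
    exact Nat.sub_add_cancel (hℓ i)
  have hrestrict : (fun y : leaves (spider ℓ) => spiderAffine ℓ h s y) = a ∘ e.symm := by
    ext y
    obtain ⟨i, rfl⟩ := e.surjective y
    simp [hval]
  rw [hnormal, hrestrict] at key
  rw [submatrix_mulVec_equiv, Function.comp_apply, key, sub_mulVec, Pi.sub_apply, mulVec_diagonal,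
    smul_mulVec, Pi.smul_apply, vecMulVec_mulVec]
  simp only [hs, hh, dotProduct, Pi.smul_apply, MulOpposite.smul_eq_mul_unop, smul_eq_mul,
    MulOpposite.unop_op]
  ring

/-- The characteristic polynomial of the Steklov matrix of a spider, away from the
reciprocals of the leg lengths. -/
theorem eval_charpoly_steklovMatrix_spider (hℓ : ∀ i, 1 ≤ ℓ i) (hι : 2 ≤ Fintype.card ι)
    [Fintype (leaves (spider ℓ))] [DecidableEq (leaves (spider ℓ))] (x : ℝ)
    (hx : ∀ i, x ≠ (ℓ i : ℝ)⁻¹) :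
    (steklovMatrix (spider ℓ) (leaves (spider ℓ))).charpoly.eval x =
      (∏ i, (x - (ℓ i : ℝ)⁻¹)) *
        (1 + (∑ i, (ℓ i : ℝ)⁻¹)⁻¹ * ∑ i, (ℓ i : ℝ)⁻¹ ^ 2 / (x - (ℓ i : ℝ)⁻¹)) := by
  have h := charpoly_reindex (spiderLeafEquiv ℓ hℓ hι).symm
    (steklovMatrix (spider ℓ) (leaves (spider ℓ)))
  rw [reindex_apply, Equiv.symm_symm, steklovMatrix_spider] at h
  rw [← h, eval_charpoly_diagonal_sub_smul_vecMulVec _ _ _ hx]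

end Spider

section ExtraSpecial

variable (b p : ℕ)

/-- Leg lengths of the extra special graph. -/
def extraSpecialLegs : Fin 1 ⊕ Fin 1 ⊕ Fin (b - 2) → ℕ
  | Sum.inl _ => p + 2
  | Sum.inr (Sum.inl _) => p + 1
  | Sum.inr (Sum.inr _) => p

def extraSpecialVertexEquiv : Spider3V 1 1 (b - 2) (p + 2) (p + 1) p ≃
    Option (Σ i, Fin (extraSpecialLegs b p i)) :=
  Equiv.optionCongr
    { toFun := fun
        | Sum.inl (i, j) => ⟨Sum.inl i, j⟩
        | Sum.inr (Sum.inl (i, j)) => ⟨Sum.inr (Sum.inl i), j⟩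
        | Sum.inr (Sum.inr (i, j)) => ⟨Sum.inr (Sum.inr i), j⟩
      invFun := fun
        | ⟨Sum.inl i, j⟩ => Sum.inl (i, j)
        | ⟨Sum.inr (Sum.inl i), j⟩ => Sum.inr (Sum.inl (i, j))
        | ⟨Sum.inr (Sum.inr i), j⟩ => Sum.inr (Sum.inr (i, j))
      left_inv := by rintro (_ | _ | _) <;> rfl
      right_inv := by rintro ⟨_ | _ | _, _⟩ <;> rfl }

/-- The extra special graph as a spider. -/
def extraSpecialIso : extraSpecial b p ≃g spider (extraSpecialLegs b p) where
  toEquiv := extraSpecialVertexEquiv b p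
  map_rel_iff' := by
    have hrel : ∀ v w, spiderRel (extraSpecialLegs b p) (extraSpecialVertexEquiv b p v)
        (extraSpecialVertexEquiv b p w) ↔ spider3Rel 1 1 (b - 2) (p + 2) (p + 1) p v w := by
      rintro (_ | ⟨_ | _ | _⟩) (_ | ⟨_ | _ | _⟩) <;>
        simp [extraSpecialVertexEquiv, spiderRel, spider3Rel]
    intro v w
    simp only [spider, extraSpecial, spider3, SimpleGraph.fromRel_adj, hrel, ne_eq,
      EmbeddingLike.apply_eq_iff_eq]

end ExtraSpecial

section Roots

variable {b p : ℕ}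

theorem eval_charpoly_steklovMatrix_extraSpecial (hp : 1 ≤ p) (hb : 3 ≤ b)
    [Fintype (leaves (extraSpecial b p))] [DecidableEq (leaves (extraSpecial b p))]
    {x : ℝ} (hx : 1 < x) :
    (b * p ^ 2 + 3 * b * p - 3 * p + 2 * b - 4) *
      (steklovMatrix (extraSpecial b p) (leaves (extraSpecial b p))).charpoly.eval x =
      x * ((b * p ^ 2 + 3 * b * p - 3 * p + 2 * b - 4) * x ^ 2 - (2 * b * p + 3 * b - 3) * x + b) *
        (x - (p : ℝ)⁻¹) ^ (b - 3) := by
  have hℓ : ∀ i, 1 ≤ extraSpecialLegs b p i := by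
    rintro (_ | _ | _) <;> simp only [extraSpecialLegs] <;> omega
  have hι : 2 ≤ Fintype.card (Fin 1 ⊕ Fin 1 ⊕ Fin (b - 2)) := by
    simp only [Fintype.card_sum, Fintype.card_fin]
    omega
  have hne : ∀ n : ℕ, 1 ≤ n → x - (n : ℝ)⁻¹ ≠ 0 := fun n hn => by
    have : (n : ℝ)⁻¹ ≤ 1 := inv_le_one_of_one_le₀ (by exact_mod_cast hn)
    linarith
  rw [charpoly_steklovMatrix_leaves_of_iso (extraSpecialIso b p),
    eval_charpoly_steklovMatrix_spider _ hℓ hι x fun i => sub_ne_zero.1 (hne _ (hℓ i))]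
  simp only [Fintype.sum_sum_type, Fintype.prod_sum_type, extraSpecialLegs, Finset.sum_const,
    Finset.prod_const, Finset.card_univ, Fintype.card_fin, one_smul, pow_one, nsmul_eq_mul]
  obtain ⟨n, rfl⟩ := Nat.exists_eq_add_of_le' hb
  have h0 := hne p hp
  have h1 := hne (p + 1) (by omega)
  have h2 := hne (p + 2) (by omega)
  rw [show n + 3 - 2 = n + 1 by omega, show n + 3 - 3 = n by omega,
    pow_succ (x - (p : ℝ)⁻¹) n]
  have hp0 : (0 : ℝ) < p := by exact_mod_cast hp
  have hn0 : (0 : ℝ) ≤ n := n.cast_nonneg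
  push_cast at h0 h1 h2 ⊢
  generalize (p : ℝ) = q at *
  generalize (n : ℝ) = m at *
  generalize hY : (x - q⁻¹) ^ n = Y
  have hS : (q + 2)⁻¹ + ((q + 1)⁻¹ + (m + 1) * q⁻¹) =
      ((m + 3) * q ^ 2 + 3 * (m + 3) * q - 3 * q + 2 * (m + 3) - 4) /
        (q * (q + 1) * (q + 2)) := by
    field_simp
    ring
  have hA : (m + 3) * q ^ 2 + 3 * (m + 3) * q - 3 * q + 2 * (m + 3) - 4 ≠ 0 := by
    have : 0 ≤ m * q := by positivity
    have : 0 ≤ m * q ^ 2 := by positivity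
    nlinarith [sq_nonneg q]
  rw [hS]
  generalize hAA : (m + 3) * q ^ 2 + 3 * (m + 3) * q - 3 * q + 2 * (m + 3) - 4 = A at *
  have e0 : x - q⁻¹ = (q * x - 1) / q := by field_simp
  have e1 : x - (q + 1)⁻¹ = ((q + 1) * x - 1) / (q + 1) := by field_simp
  have e2 : x - (q + 2)⁻¹ = ((q + 2) * x - 1) / (q + 2) := by field_simp
  have f0 : q * x - 1 ≠ 0 := fun h => h0 (by rw [e0, h, zero_div])
  have f1 : (q + 1) * x - 1 ≠ 0 := fun h => h1 (by rw [e1, h, zero_div])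
  have f2 : (q + 2) * x - 1 ≠ 0 := fun h => h2 (by rw [e2, h, zero_div])
  rw [e0, e1, e2]
  have g1 : q + 1 ≠ 0 := by positivity
  have g2 : q + 2 ≠ 0 := by positivity
  generalize ha0 : q * x - 1 = a₀ at *
  generalize ha1 : (q + 1) * x - 1 = a₁ at *
  generalize ha2 : (q + 2) * x - 1 = a₂ at *
  field_simp
  rw [← ha0, ← ha1, ← ha2, ← hAA]
  ring

theorem roots_charpoly_steklovMatrix_extraSpecial (hp : 1 ≤ p) (hb : 3 ≤ b)
    {_ : Fintype (leaves (extraSpecial b p))} {_ : DecidableEq (leaves (extraSpecial b p))}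
    {A σ τ : ℝ} (hA : A = b * p ^ 2 + 3 * b * p - 3 * p + 2 * b - 4) (hA0 : A ≠ 0)
    (hadd : A * (σ + τ) = 2 * b * p + 3 * b - 3) (hmul : A * (σ * τ) = b) :
    (steklovMatrix (extraSpecial b p) (leaves (extraSpecial b p))).charpoly.roots =
      ({0, σ, τ} : Multiset ℝ) + Multiset.replicate (b - 3) (1 / (p : ℝ)) := by
  set s : Multiset ℝ := ({0, σ, τ} : Multiset ℝ) + Multiset.replicate (b - 3) (1 / (p : ℝ))
    with hs
  have hpoly : (steklovMatrix (extraSpecial b p) (leaves (extraSpecial b p))).charpoly =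
      (s.map fun a => Polynomial.X - Polynomial.C a).prod := by
    refine Polynomial.eq_of_infinite_eval_eq _ _ ((Set.Ioi_infinite (1 : ℝ)).mono fun x hx => ?_)
    have h := eval_charpoly_steklovMatrix_extraSpecial hp hb hx
    rw [← hA, ← hadd] at h
    refine mul_left_cancel₀ hA0 (h.trans ?_)
    simp only [hs, Multiset.insert_eq_cons, Multiset.map_add, Multiset.map_cons,
      Multiset.map_singleton, Multiset.map_replicate, Multiset.prod_add, Multiset.prod_cons,
      Multiset.prod_singleton, Multiset.prod_replicate, Polynomial.eval_mul, Polynomial.eval_sub,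
      Polynomial.eval_X, Polynomial.eval_C, Polynomial.eval_pow, one_div]
    linear_combination (-x * (x - (p : ℝ)⁻¹) ^ (b - 3)) * hmul
  rw [hpoly, Polynomial.roots_multiset_prod_X_sub_C]

theorem kthEig_eq_getD {ι : Type*} {_ : Fintype ι} {_ : DecidableEq ι} {M : Matrix ι ι ℝ}
    {l : List ℝ} (hM : M.charpoly.roots = l) (hl : l.Pairwise (· ≤ ·)) (k : ℕ) :
    kthEig M k = l.getD (k - 1) 0 := by
  rw [kthEig, hM]
  congr 1
  refine List.Perm.eq_of_pairwise' (Multiset.pairwise_sort _ _) hl ?_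
  rw [← Multiset.coe_eq_coe, Multiset.sort_eq]

theorem steklovEig_extraSpecial (hp : 1 ≤ p) (hb : 3 ≤ b) {A σ τ : ℝ}
    (hA : A = b * p ^ 2 + 3 * b * p - 3 * p + 2 * b - 4) (hA0 : A ≠ 0)
    (hadd : A * (σ + τ) = 2 * b * p + 3 * b - 3) (hmul : A * (σ * τ) = b)
    (hσ : 0 ≤ σ) (hστ : σ ≤ τ) (hτ : τ ≤ 1 / (p : ℝ)) (k : ℕ) :
    steklovEig (extraSpecial b p) (leaves (extraSpecial b p)) k =
      (0 :: σ :: τ :: List.replicate (b - 3) (1 / (p : ℝ))).getD (k - 1) 0 := by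
  have hcoe : ({0, σ, τ} : Multiset ℝ) + Multiset.replicate (b - 3) (1 / (p : ℝ)) =
      (0 :: σ :: τ :: List.replicate (b - 3) (1 / (p : ℝ)) : List ℝ) := by
    rw [← Multiset.cons_coe, ← Multiset.cons_coe, ← Multiset.cons_coe, Multiset.coe_replicate]
    simp only [Multiset.insert_eq_cons, Multiset.cons_add, Multiset.singleton_add]
  rw [steklovEig]
  refine kthEig_eq_getD
    ((roots_charpoly_steklovMatrix_extraSpecial hp hb hA hA0 hadd hmul).trans hcoe) ?_ k
  have hr : ∀ a ∈ List.replicate (b - 3) (1 / (p : ℝ)), a = 1 / (p : ℝ) :=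
    fun a ha => List.eq_of_mem_replicate ha
  simp only [List.pairwise_cons, List.mem_cons]
  refine ⟨?_, ?_, ?_, List.pairwise_replicate.2 (Or.inr le_rfl)⟩
  · rintro a (rfl | rfl | ha)
    · exact hσ
    · exact hσ.trans hστ
    · rw [hr a ha]
      positivity
  · rintro a (rfl | ha)
    · exact hστ
    · exact (hr a ha).symm ▸ hστ.trans hτ
  · exact fun a ha => (hr a ha).symm ▸ hτ

theorem extraSpecial_leadingCoeff_pos (hp : (1 : ℝ) ≤ p) (hb : (3 : ℝ) ≤ b) :
    (0 : ℝ) < b * p ^ 2 + 3 * b * p - 3 * p + 2 * b - 4 := by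
  have hbp : 0 ≤ ((b : ℝ) - 3) * (p - 1) := mul_nonneg (by linarith) (by linarith)
  have : 0 ≤ (b : ℝ) * p ^ 2 := by positivity
  nlinarith

end Roots

/-- **Lemma (Steklov spectrum of the extra special graph).**
For `p ≥ 1`, `b ≥ 3`, the Steklov spectrum of `ES_{b;p}` with leaves as boundary is
`σ₁ = 0`, `σ₂ = σ⁻`, `σ₃ = σ⁺`, and `σ₄ = ⋯ = σ_b = 1/p`, where
`σ^± = (2bp + 3b − 3 ± √(b² − 2b + 9)) / (2(bp² + 3bp − 3p + 2b − 4))`; as a multiset the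
spectrum is `{0, σ⁻, σ⁺}` together with `1/p` with multiplicity `b − 3` (so for `b = 3`
the eigenvalue `1/p` does not occur). -/
theorem steklov_spectrum_extraSpecial (b p : ℕ) (hp : 1 ≤ p) (hb : 3 ≤ b) :
    (steklovMatrix (extraSpecial b p) (leaves (extraSpecial b p))).charpoly.roots =
      ({0,
        (2 * (b : ℝ) * p + 3 * b - 3 - Real.sqrt ((b : ℝ) ^ 2 - 2 * b + 9)) /
          (2 * ((b : ℝ) * p ^ 2 + 3 * b * p - 3 * p + 2 * b - 4)),
        (2 * (b : ℝ) * p + 3 * b - 3 + Real.sqrt ((b : ℝ) ^ 2 - 2 * b + 9)) /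
          (2 * ((b : ℝ) * p ^ 2 + 3 * b * p - 3 * p + 2 * b - 4))} : Multiset ℝ) +
      Multiset.replicate (b - 3) (1 / (p : ℝ)) ∧
    steklovEig (extraSpecial b p) (leaves (extraSpecial b p)) 1 = 0 ∧
    steklovEig (extraSpecial b p) (leaves (extraSpecial b p)) 2 =
      (2 * (b : ℝ) * p + 3 * b - 3 - Real.sqrt ((b : ℝ) ^ 2 - 2 * b + 9)) /
        (2 * ((b : ℝ) * p ^ 2 + 3 * b * p - 3 * p + 2 * b - 4)) ∧
    steklovEig (extraSpecial b p) (leaves (extraSpecial b p)) 3 =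
      (2 * (b : ℝ) * p + 3 * b - 3 + Real.sqrt ((b : ℝ) ^ 2 - 2 * b + 9)) /
        (2 * ((b : ℝ) * p ^ 2 + 3 * b * p - 3 * p + 2 * b - 4)) ∧
    (∀ k : ℕ, 4 ≤ k → k ≤ b →
      steklovEig (extraSpecial b p) (leaves (extraSpecial b p)) k = 1 / (p : ℝ)) := by
  have hp1 : (1 : ℝ) ≤ p := by exact_mod_cast hp
  have hb3 : (3 : ℝ) ≤ b := by exact_mod_cast hb
  have hA0 := extraSpecial_leadingCoeff_pos hp1 hb3
  have hD0 : 0 ≤ Real.sqrt ((b : ℝ) ^ 2 - 2 * b + 9) := Real.sqrt_nonneg _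
  have hDsq : Real.sqrt ((b : ℝ) ^ 2 - 2 * b + 9) ^ 2 = (b : ℝ) ^ 2 - 2 * b + 9 :=
    Real.sq_sqrt (by nlinarith [sq_nonneg (b - 1 : ℝ)])
  generalize Real.sqrt ((b : ℝ) ^ 2 - 2 * b + 9) = D at *
  generalize hA : (b : ℝ) * p ^ 2 + 3 * b * p - 3 * p + 2 * b - 4 = A at *
  have hDb : D ≤ b + 1 := (abs_le_of_sq_le_sq' (by linarith) (by linarith)).2
  have hbp : 0 ≤ ((b : ℝ) - 3) * (p - 1) := mul_nonneg (by linarith) (by linarith)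
  generalize hσ : (2 * (b : ℝ) * p + 3 * b - 3 - D) / (2 * A) = σ
  generalize hτ : (2 * (b : ℝ) * p + 3 * b - 3 + D) / (2 * A) = τ
  have hadd : A * (σ + τ) = 2 * b * p + 3 * b - 3 := by
    rw [← hσ, ← hτ]
    field_simp
    ring
  have hmul : A * (σ * τ) = b := by
    rw [← hσ, ← hτ]
    field_simp
    rw [← hA]
    linear_combination -hDsq
  have h0σ : 0 ≤ σ := hσ ▸ div_nonneg (by linarith) (by linarith)
  have hστ : σ ≤ τ := by
    rw [← hσ, ← hτ]
    gcongr
    linarith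
  have hτp : τ ≤ 1 / (p : ℝ) := by
    rw [← hτ, div_le_div_iff₀ (by linarith) (by linarith), ← hA]
    linarith [mul_le_mul_of_nonneg_right hDb (by linarith : (0 : ℝ) ≤ p)]
  have heig := steklovEig_extraSpecial hp hb hA.symm hA0.ne' hadd hmul h0σ hστ hτp
  refine ⟨roots_charpoly_steklovMatrix_extraSpecial hp hb hA.symm hA0.ne' hadd hmul,
    heig 1, heig 2, heig 3, fun k hk hkb => ?_⟩
  obtain ⟨j, rfl⟩ := Nat.exists_eq_add_of_le' hk
  have hj : j < b - 3 := by omega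
  rw [heig]
  simp [hj]

end
end

section
/- Let b ≥ 3 and t ≥ 0 be integers. If T is a tree with b leaves and diameter at most 4t+3, then the matching number of T is at most bt+2. -/
open scoped Classical

noncomputable section

namespace SimpleGraph

variable {V : Type*} {G : SimpleGraph V}

lemma Connected.exists_adj_dist_add_one (hG : G.Connected) {r x : V} (h : r ≠ x) :
    ∃ y, G.Adj x y ∧ G.dist r y + 1 = G.dist r x := by
  obtain ⟨p, hp⟩ := hG.exists_walk_length_eq_dist x r
  cases p with
  | nil => exact absurd rfl h
  | @cons _ y _ hxy q =>
    refine ⟨y, hxy, ?_⟩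
    have h₁ := dist_le q
    have h₂ := hG.dist_triangle (u := x) (v := y) (w := r)
    rw [Walk.length_cons] at hp
    rw [dist_eq_one_iff_adj.2 hxy] at h₂
    rw [dist_comm (u := r), dist_comm (u := r)]
    omega

lemma IsTree.eq_of_adj_of_dist_add_one (hG : G.IsTree) {r x y z : V}
    (hy : G.Adj x y) (hz : G.Adj x z) (hyr : G.dist r y + 1 = G.dist r x)
    (hzr : G.dist r z + 1 = G.dist r x) : y = z := by
  obtain ⟨p, hp⟩ := hG.connected.exists_walk_length_eq_dist y r
  obtain ⟨q, hq⟩ := hG.connected.exists_walk_length_eq_dist z r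
  have hp' : (Walk.cons hy p).IsPath := Walk.isPath_of_length_eq_dist _ (by
    rw [Walk.length_cons, hp, dist_comm, hyr, dist_comm])
  have hq' : (Walk.cons hz q).IsPath := Walk.isPath_of_length_eq_dist _ (by
    rw [Walk.length_cons, hq, dist_comm, hzr, dist_comm])
  have := (hG.existsUnique_path x r).unique hp' hq'
  simp only [Walk.cons.injEq] at this
  exact this.1

/-- In a tree, a geodesic whose first step moves away from `x` keeps moving away from `x`. -/
lemma IsTree.dist_eq_dist_add_of_dist_eq_add_one (hG : G.IsTree) {x z : V} (n : ℕ) {u v : V}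
    (huv : G.Adj u v) (hx : G.dist x v = G.dist x u + 1) (hu : G.dist z u = n + 1)
    (hv : G.dist z v = n) : G.dist x z = G.dist x v + n := by
  induction n generalizing u v with
  | zero => rw [hG.connected.dist_eq_zero_iff.1 hv, add_zero]
  | succ n ih =>
    have hne : z ≠ v := by
      rintro rfl
      simp at hv
    obtain ⟨w, hw, hwz⟩ := hG.connected.exists_adj_dist_add_one hne
    have hwx : G.dist x w = G.dist x v + 1 := by
      rcases hG.dist_eq_dist_add_one_of_adj x hw with h | h
      · have := hG.eq_of_adj_of_dist_add_one hw huv.symm h.symm hx.symm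
        subst this
        omega
      · exact h
    have := ih hw hwx hv (by omega)
    omega

/-- The distance from `x` to the closer endpoint of the pair `u`, `v`. -/
def pairDepth (G : SimpleGraph V) (u v x : V) : ℕ := min (G.dist u x) (G.dist v x)

lemma IsTree.not_dist_lt_of_dist_lt (hG : G.IsTree) {u v x y : V} (huv : G.Adj u v)
    (hv : v ≠ x) (hxy : G.Adj x y) (hu' : G.dist u x = G.dist u y + 1)
    (hv' : G.dist v y = G.dist v x + 1) : False := by
  have key (a : V) : G.dist u a ≤ G.dist v a + 1 ∧ G.dist v a ≤ G.dist u a + 1 := by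
    have h₁ := hG.connected.dist_triangle (u := u) (v := v) (w := a)
    have h₂ := hG.connected.dist_triangle (u := v) (v := u) (w := a)
    rw [dist_eq_one_iff_adj.2 huv] at h₁
    rw [dist_eq_one_iff_adj.2 huv.symm] at h₂
    omega
  obtain ⟨w, hw, hwv⟩ := hG.connected.exists_adj_dist_add_one hv
  have hx := key x
  have hy := key y
  have hkw := key w
  rcases hG.dist_eq_dist_add_one_of_adj u hw with h | h
  · have := hG.eq_of_adj_of_dist_add_one hw hxy h.symm hu'.symm
    subst this
    omega
  · omega

/-- Passing to a neighbour changes the distances to both ends of an edge in the same direction,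
unless one starts at an end of that edge. -/
lemma IsTree.pairDepth_adj (hG : G.IsTree) {u v x y : V} (huv : G.Adj u v)
    (hx : 1 ≤ G.pairDepth u v x) (hxy : G.Adj x y) :
    (G.pairDepth u v y = G.pairDepth u v x + 1 ∧ G.dist u y = G.dist u x + 1) ∨
      (G.pairDepth u v y + 1 = G.pairDepth u v x ∧ G.dist u y + 1 = G.dist u x) := by
  unfold pairDepth at *
  have hu : u ≠ x := by
    rintro rfl
    simp at hx
  have hv : v ≠ x := by
    rintro rfl
    simp at hx
  rcases hG.dist_eq_dist_add_one_of_adj u hxy with h | h <;>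
    rcases hG.dist_eq_dist_add_one_of_adj v hxy with h' | h'
  · omega
  · exact (hG.not_dist_lt_of_dist_lt huv hv hxy h h').elim
  · exact (hG.not_dist_lt_of_dist_lt huv.symm hu hxy h' h).elim
  · omega

/-- Every vertex off the edge `uv` is obtained from some leaf by iterating the parent map. -/
lemma IsTree.exists_leaf_iterate_eq [Finite V] (hG : G.IsTree) {u v : V} (huv : G.Adj u v)
    (p : V → V) (hp : ∀ x, u ≠ x → G.Adj x (p x) ∧ G.dist u (p x) + 1 = G.dist u x)
    {x : V} (hx : 1 ≤ G.pairDepth u v x) :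
    ∃ l ∈ leaves G, ∃ n, p^[n] l = x ∧ G.pairDepth u v l = G.pairDepth u v x + n := by
  obtain ⟨M, hM⟩ := (Set.finite_range (G.pairDepth u v)).bddAbove
  have hM (a : V) : G.pairDepth u v a ≤ M := hM ⟨a, rfl⟩
  induction hk : M - G.pairDepth u v x using Nat.strong_induction_on generalizing x with
  | _ k ih =>
    by_cases hl : x ∈ leaves G
    · exact ⟨x, hl, 0, rfl, rfl⟩
    have hu : u ≠ x := by
      rintro rfl
      simp [pairDepth] at hx
    obtain ⟨w, hw, hwp⟩ : ∃ w, G.Adj x w ∧ w ≠ p x := by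
      by_contra! h
      apply hl
      have : G.neighborSet x = {p x} := by
        ext w
        refine ⟨h w, ?_⟩
        rintro rfl
        exact (hp x hu).1
      simp [leaves, this]
    rcases hG.pairDepth_adj huv hx hw with ⟨hd, hdu⟩ | ⟨-, hdu⟩
    · have hMw := hM w
      obtain ⟨l, hl, n, hn, hln⟩ := ih _ (by omega) (x := w) (by omega) rfl
      have huw : u ≠ w := by
        rintro rfl
        simp at hdu
      obtain ⟨hpw, hpu⟩ := hp w huw
      refine ⟨l, hl, n + 1, ?_, by omega⟩
      rw [Function.iterate_succ_apply', hn]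
      exact hG.eq_of_adj_of_dist_add_one hpw hw.symm hpu hdu.symm
    · exact absurd (hG.eq_of_adj_of_dist_add_one hw (hp x hu).1 hdu (hp x hu).2) hwp

lemma IsTree.ncard_pairDepth_eq_le [Finite V] (hG : G.IsTree) {u v : V} (huv : G.Adj u v)
    {k : ℕ} (hk : 1 ≤ k) : {x | G.pairDepth u v x = k}.ncard ≤ (leaves G).ncard := by
  choose! p hp using fun x (h : u ≠ x) => hG.connected.exists_adj_dist_add_one h
  choose! l hl n hn hln using fun x (hx : 1 ≤ G.pairDepth u v x) =>
    hG.exists_leaf_iterate_eq huv p hp hx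
  refine Set.ncard_le_ncard_of_injOn l ?_ ?_ (Set.toFinite _)
  · intro x hx
    exact hl x (hk.trans_eq hx.symm)
  · intro x hx y hy hxy
    have hx' : 1 ≤ G.pairDepth u v x := hk.trans_eq hx.symm
    have hy' : 1 ≤ G.pairDepth u v y := hk.trans_eq hy.symm
    have h₁ := hln x hx'
    have h₂ := hln y hy'
    rw [Set.mem_ofPred_eq] at hx hy
    rw [← hn x hx', ← hn y hy', hxy, show n x = n y by rw [hxy] at h₁; omega]

lemma Connected.dist_le_diam [Finite V] (hG : G.Connected) (x y : V) : G.dist x y ≤ G.diam :=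
  have := hG.nonempty
  SimpleGraph.dist_le_diam (connected_iff_ediam_ne_top.1 hG)

/-- A tree of diameter at most `2 * r + 1` is covered by balls of radius `r` around the ends of
an edge. -/
lemma IsTree.exists_adj_pairDepth_le [Finite V] [Nontrivial V] (hG : G.IsTree) {r : ℕ}
    (hdiam : G.diam ≤ 2 * r + 1) : ∃ u v, G.Adj u v ∧ ∀ x, G.pairDepth u v x ≤ r := by
  have hle (x y : V) := hG.connected.dist_le_diam x y
  obtain ⟨a, z, haz⟩ := G.exists_dist_eq_diam
  rcases le_or_gt G.diam r with hd | hd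
  · obtain ⟨v, hv⟩ := hG.connected.preconnected.exists_adj_of_nontrivial a
    exact ⟨a, v, hv, fun x => (min_le_left _ _).trans ((hle a x).trans hd)⟩
  · obtain ⟨p, hp⟩ := hG.connected.exists_walk_length_eq_dist a z
    have ha (i : ℕ) (hi : i ≤ p.length) :
        G.dist a (p.getVert i) = i ∧ G.dist z (p.getVert i) + i = G.diam := by
      have h₁ := dist_le (p.take i)
      have h₂ := dist_le (p.drop i)
      have h₃ := hG.connected.dist_triangle (u := a) (v := p.getVert i) (w := z)
      rw [Walk.take_length] at h₁
      rw [Walk.drop_length] at h₂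
      rw [dist_comm (u := z)]
      omega
    obtain ⟨hau, hzu⟩ := ha r (by omega)
    obtain ⟨hav, hzv⟩ := ha (r + 1) (by omega)
    have huv := p.adj_getVert_succ (i := r) (by omega)
    refine ⟨_, _, huv, fun x => ?_⟩
    by_contra! hlt
    rw [pairDepth, lt_min_iff, dist_comm, dist_comm (v := x)] at hlt
    have hxa := hle x a
    have hxz := hle x z
    rcases hG.dist_eq_dist_add_one_of_adj x huv with h | h
    · have := hG.dist_eq_dist_add_of_dist_eq_add_one r huv.symm h hav hau
      omega
    · have := hG.dist_eq_dist_add_of_dist_eq_add_one (z := z) (G.diam - (r + 1)) huv h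
        (by omega) (by omega)
      omega

/-- The vertices at even depth below an edge cover every edge of a tree. -/
lemma IsTree.even_pairDepth_or (hG : G.IsTree) {u v x y : V} (huv : G.Adj u v)
    (hxy : G.Adj x y) : Even (G.pairDepth u v x) ∨ Even (G.pairDepth u v y) := by
  rcases Nat.eq_zero_or_pos (G.pairDepth u v x) with h | h
  · simp [h]
  · have := hG.pairDepth_adj huv h hxy
    grind

lemma IsTree.ncard_even_pairDepth_le [Finite V] (hG : G.IsTree) {u v : V} (huv : G.Adj u v)
    {t : ℕ} (h : ∀ x, G.pairDepth u v x ≤ 2 * t + 1) :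
    {x | Even (G.pairDepth u v x)}.ncard ≤ (leaves G).ncard * t + 2 := by
  have hsub : {x | Even (G.pairDepth u v x)} ⊆
      (⋃ j ∈ Finset.Icc 1 t, {x | G.pairDepth u v x = 2 * j}) ∪ {u, v} := by
    rintro x ⟨j, hj⟩
    rcases Nat.eq_zero_or_pos j with rfl | hj0
    · right
      have := hG.connected
      rw [pairDepth, add_zero, Nat.min_eq_zero_iff, this.dist_eq_zero_iff,
        this.dist_eq_zero_iff] at hj
      exact hj.imp Eq.symm Eq.symm
    · left
      have := h x
      simp only [Set.mem_iUnion, Finset.mem_Icc]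
      exact ⟨j, by omega, hj.trans (two_mul j).symm⟩
  refine (Set.ncard_le_ncard hsub (Set.toFinite _)).trans ((Set.ncard_union_le _ _).trans ?_)
  refine add_le_add ?_ ((Set.ncard_insert_le _ _).trans (by simp))
  refine (Finset.set_ncard_biUnion_le _ _).trans ?_
  refine (Finset.sum_le_card_nsmul _ _ (leaves G).ncard fun j hj => ?_).trans ?_
  · rw [Finset.mem_Icc] at hj
    exact hG.ncard_pairDepth_eq_le huv (by omega)
  · simp [mul_comm]

end SimpleGraph

/-- The size of a vertex cover bounds the size of a matching. -/
lemma IsMatchingSet.ncard_le_of_cover {V : Type*} [Finite V] {G : SimpleGraph V}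
    {s : Set (Sym2 V)} (hs : IsMatchingSet G s) {C : Set V}
    (hC : ∀ x y, G.Adj x y → x ∈ C ∨ y ∈ C) : s.ncard ≤ C.ncard := by
  have hex (e : Sym2 V) (he : e ∈ s) : ∃ x ∈ e, x ∈ C := by
    induction e with
    | _ x y =>
      rcases hC x y (hs.1 he) with h | h
      · exact ⟨x, Sym2.mem_mk_left x y, h⟩
      · exact ⟨y, Sym2.mem_mk_right x y, h⟩
  rcases s.eq_empty_or_nonempty with rfl | ⟨e₀, he₀⟩
  · simp
  have : Nonempty V := ⟨(hex e₀ he₀).choose⟩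
  choose! c hce hcC using hex
  refine Set.ncard_le_ncard_of_injOn c hcC ?_ (Set.toFinite _)
  intro e he f hf hef
  by_contra hne
  exact hs.2 he hf hne (c e) (hce e he) (hef ▸ hce f hf)

/-- **Lemma.** A tree with `b ≥ 3` leaves and diameter at most `4t+3` (`t ≥ 0`) has
matching number at most `bt+2`. -/
theorem matching_le_of_diam_le_four_mul_add_three
    {V : Type*} [Fintype V] (b t : ℕ) (hb : 3 ≤ b)
    (T : SimpleGraph V) (hT : T.IsTree)
    (hleaf : (leaves T).ncard = b) (hdiam : T.diam ≤ 4 * t + 3) :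
    matchingNumber T ≤ b * t + 2 := by
  have : Nontrivial V := by
    rw [← not_subsingleton_iff_nontrivial]
    intro h
    have := Set.ncard_le_one_of_subsingleton (leaves T)
    omega
  obtain ⟨u, v, huv, hD⟩ := hT.exists_adj_pairDepth_le (r := 2 * t + 1) (by omega)
  refine csSup_le' ?_
  rintro _ ⟨s, hs, rfl⟩
  refine (hs.ncard_le_of_cover fun x y hxy => hT.even_pairDepth_or huv hxy).trans ?_
  exact hleaf ▸ hT.ncard_even_pairDepth_le huv hD

end
end
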